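/- For every n there is a bijection ψ' between T⁰_n and S_n such that if τ ∈ T⁰_n and σ = ψ'(τ), then D(τ) = D(σ); moreover if the entry 0 occupies position k of τ, then σ(k) = 1. -/

import Mathlib

def descSeq {n : ℕ} (f : Fin n → ℕ) : Finset ℕ :=
  (Finset.range (n - 1)).filter
    (fun i => ∃ h : i + 1 < n, f ⟨i + 1, h⟩ < f ⟨i, Nat.lt_of_succ_lt h⟩)

def descSet {n : ℕ} (σ : Equiv.Perm (Fin n)) : Finset ℕ :=
  descSeq (fun i => (σ i : ℕ))

def IsCyclic' {n : ℕ} (π : Equiv.Perm (Fin n)) : Prop :=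
  ∀ x y : Fin n, ∃ k : ℕ, (π ^ k) x = y

def compParts (n : ℕ) (I : Finset ℕ) : Multiset ℕ :=
  ↑(List.zipWith (· - ·) ((I.sort (· ≤ ·)).map (· + 1) ++ [n])
      (0 :: (I.sort (· ≤ ·)).map (· + 1)))

def fullCycleType {n : ℕ} (π : Equiv.Perm (Fin n)) : Multiset ℕ :=
  π.cycleType + Multiset.replicate (n - π.support.card) 1

def InT0 (n : ℕ) (τ : Fin n → ℕ) : Prop :=
  ∃ (π : Equiv.Perm (Fin n)) (k : Fin n), IsCyclic' π ∧
    τ = Function.update (fun i => ((π i : ℕ) + 1)) k 0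

def InU (n : ℕ) (τ : Fin n → ℕ) : Prop :=
  ∃ (π : Equiv.Perm (Fin n)) (k : Fin n), IsCyclic' π ∧
    τ = Function.update (fun i => ((π i : ℕ) + 1)) k (n + 1)

def extPerm {n : ℕ} (π : Equiv.Perm (Fin n)) : Equiv.Perm (Fin (n + 1)) :=
  (finSuccEquivLast (n := n)).symm.permCongr π.optionCongr

def extCycle {n : ℕ} (π : Equiv.Perm (Fin n)) (k : Fin n) : Equiv.Perm (Fin (n + 1)) :=
  extPerm π * Equiv.swap (Fin.castSucc k) (Fin.last n)

open Finset in
theorem card_filter_subset_eq_sum_ssubsets_add {α γ : Type*} [DecidableEq γ]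
    (A : Finset α) (d : α → Finset γ) (I : Finset γ) :
    #{a ∈ A | d a ⊆ I} = ∑ J ∈ I.ssubsets, #{a ∈ A | d a = J} + #{a ∈ A | d a = I} := by
  have h1 : #{a ∈ A | d a ⊆ I} = ∑ J ∈ I.powerset, #{a ∈ {a ∈ A | d a ⊆ I} | d a = J} :=
    card_eq_sum_card_fiberwise (fun a ha => by simpa using (mem_filter.1 ha).2)
  have h2 : ∀ J ∈ I.powerset,
      #{a ∈ {a ∈ A | d a ⊆ I} | d a = J} = #{a ∈ A | d a = J} := by
    intro J hJ
    rw [filter_filter]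
    congr 1
    ext a
    simp only [mem_filter, mem_powerset] at hJ ⊢
    grind
  rw [h1, sum_congr rfl h2, ssubsets, sum_erase_add _ _ (mem_powerset_self I)]

open Finset in
/-- Möbius inversion on finite sets: a set-valued statistic is equidistributed as soon as its
cumulative counts agree. -/
theorem card_filter_eq_of_card_filter_subset {α β γ : Type*} [DecidableEq γ]
    (A : Finset α) (B : Finset β) (d : α → Finset γ) (e : β → Finset γ)
    (h : ∀ I, #{a ∈ A | d a ⊆ I} = #{b ∈ B | e b ⊆ I}) (I : Finset γ) :
    #{a ∈ A | d a = I} = #{b ∈ B | e b = I} := by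
  induction I using Finset.strongInduction with
  | H I ih =>
    have h0 := h I
    rw [card_filter_subset_eq_sum_ssubsets_add, card_filter_subset_eq_sum_ssubsets_add, sum_congr rfl fun J hJ => ih J (mem_ssubsets.1 hJ)] at h0
    exact Nat.add_left_cancel h0

/-- Two maps from finite types with equinumerous fibers differ by an equivalence. -/
theorem exists_equiv_of_card_fiber_eq {α β γ : Type*} [Fintype α] [Fintype β] [DecidableEq γ]
    (f : α → γ) (g : β → γ)
    (h : ∀ c, (Finset.univ.filter fun a => f a = c).card
      = (Finset.univ.filter fun b => g b = c).card) :
    ∃ e : α ≃ β, ∀ a, g (e a) = f a := by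
  have hc : ∀ c, Nonempty ({a // f a = c} ≃ {b // g b = c}) := fun c => by
    rw [← Fintype.card_eq, Fintype.card_subtype, Fintype.card_subtype]
    exact h c
  exact ⟨Equiv.ofFiberEquiv fun c => (hc c).some, fun a => Equiv.ofFiberEquiv_map _ a⟩

/-- `f` is strictly increasing on every fiber of `c`. -/
def StrictMonoOnFibers {α β γ : Type*} [LT α] [LT β] (c : α → γ) (f : α → β) : Prop :=
  ∀ x y, x < y → c x = c y → f x < f y

/-- If `κ w` is an injective key refining `w`, then the permutations `ρ` with `ρ 0 = k` which sort
the key of their own word `c ∘ ρ` are in bijection with all words `c ∘ ρ` with `ρ 0 = k`. -/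
theorem bijOn_comp_of_key {m : ℕ} {L : Type*} [LinearOrder L] {c : Fin (m + 1) → ℕ}
    {k : Fin (m + 1)} (hc : Monotone c) (hk : ∀ x, c x = c k → x = k)
    (κ : (Fin (m + 1) → ℕ) → Fin (m + 1) → L)
    (href : ∀ w i j, κ w i ≤ κ w j → w i ≤ w j)
    (hinj : ∀ w : Fin (m + 1) → ℕ, (∀ i, w i = w 0 → i = 0) → Function.Injective (κ w)) :
    Set.BijOn (fun ρ : Equiv.Perm (Fin (m + 1)) => c ∘ ρ)
      {ρ | ρ 0 = k ∧ Monotone (κ (c ∘ ρ) ∘ ⇑ρ⁻¹)}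
      ((fun ρ : Equiv.Perm (Fin (m + 1)) => c ∘ ρ) '' {ρ | ρ 0 = k}) := by
  have hsep : ∀ ρ : Equiv.Perm (Fin (m + 1)), ρ 0 = k →
      Function.Injective (κ (c ∘ ρ)) := by
    intro ρ h0
    refine hinj _ fun i hi => ?_
    have := hk (ρ i) (by simpa [h0] using hi)
    exact ρ.injective (this.trans h0.symm)
  refine ⟨fun ρ hρ => ⟨ρ, hρ.1, rfl⟩, ?_, ?_⟩
  · rintro ρ ⟨h0, h1⟩ ρ' ⟨h0', h1'⟩ (heq : c ∘ ρ = c ∘ ρ')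
    rw [← heq] at h1'
    have h2 := Tuple.unique_monotone h1 h1'
    have h3 : ρ⁻¹ = ρ'⁻¹ := Equiv.ext fun x => hsep ρ h0 (congrFun h2 x)
    exact inv_injective h3
  · rintro _ ⟨ρ₀, h0, rfl⟩
    set w := c ∘ ρ₀ with hw
    have hs : Monotone (κ w ∘ Tuple.sort (κ w)) := Tuple.monotone_sort _
    have h1 : Monotone (w ∘ Tuple.sort (κ w)) := fun x y hxy => href w _ _ (hs hxy)
    have h2 : Monotone (w ∘ ⇑ρ₀⁻¹) := by
      intro x y hxy
      simpa [hw] using hc hxy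
    have h3 := Tuple.unique_monotone h1 h2
    have h4 : c ∘ ⇑(Tuple.sort (κ w))⁻¹ = w := by
      funext i
      have := congrFun h3 ((Tuple.sort (κ w))⁻¹ i)
      simpa [hw] using this.symm
    refine ⟨(Tuple.sort (κ w))⁻¹, ⟨?_, ?_⟩, h4⟩
    · apply hk
      rw [← h0]
      exact congrFun h4 0
    · rw [h4, inv_inv]
      exact hs

theorem monotone_prodKey_iff {m : ℕ} {c : Fin (m + 1) → ℕ} (hc : Monotone c)
    (ρ : Equiv.Perm (Fin (m + 1))) :
    Monotone ((fun i => toLex ((c ∘ ρ) i, i)) ∘ ⇑ρ⁻¹) ↔ StrictMonoOnFibers c ⇑ρ⁻¹ := by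
  constructor
  · intro h x y hxy hcxy
    have h1 := h hxy.le
    simp only [Function.comp_apply, ← Equiv.Perm.mul_apply, mul_inv_cancel, Equiv.Perm.one_apply, Prod.Lex.toLex_le_toLex] at h1
    rcases h1 with h1 | ⟨-, h1⟩
    · omega
    · exact lt_of_le_of_ne h1 fun h2 => hxy.ne (ρ⁻¹.injective h2)
  · intro h x y hxy
    simp only [Function.comp_apply, ← Equiv.Perm.mul_apply, mul_inv_cancel, Equiv.Perm.one_apply, Prod.Lex.toLex_le_toLex]
    rcases hxy.eq_or_lt with rfl | hlt
    · exact Or.inr ⟨rfl, le_rfl⟩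
    · rcases (hc hxy).eq_or_lt with h1 | h1
      · exact Or.inr ⟨h1, (h x y hlt h1).le⟩
      · exact Or.inl h1

/-- The periodic sequence read off from the cyclic word `w`, starting at `i`, ordered
lexicographically. -/
def cyclicKey {m : ℕ} (w : Fin (m + 1) → ℕ) (i : Fin (m + 1)) : Lex (ℕ → ℕ) :=
  toLex fun j => w ((finRotate (m + 1) ^ j) i)

theorem cyclicKey_lt_iff {m : ℕ} (w : Fin (m + 1) → ℕ) (i j : Fin (m + 1)) :
    cyclicKey w i < cyclicKey w j ↔ ∃ l,
      (∀ s < l, w ((finRotate (m + 1) ^ s) i) = w ((finRotate (m + 1) ^ s) j)) ∧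
        w ((finRotate (m + 1) ^ l) i) < w ((finRotate (m + 1) ^ l) j) :=
  Iff.rfl

theorem apply_le_of_cyclicKey_le {m : ℕ} (w : Fin (m + 1) → ℕ) (i j : Fin (m + 1))
    (h : cyclicKey w i ≤ cyclicKey w j) : w i ≤ w j := by
  by_contra! hlt
  exact h.not_gt ((cyclicKey_lt_iff w j i).2 ⟨0, by simp, by simpa using hlt⟩)

theorem finRotate_pow_val_apply {m : ℕ} (a i : Fin (m + 1)) :
    (finRotate (m + 1) ^ (a : ℕ)) i = i + a := by
  have h : ∀ j : ℕ, (((finRotate (m + 1) ^ j) i : Fin (m + 1)) : ℕ) = (i + j) % (m + 1) := by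
    intro j
    induction j with
    | zero => simp [Nat.mod_eq_of_lt i.2]
    | succ j ih =>
      rw [pow_succ', Equiv.Perm.mul_apply, finRotate_apply, Fin.val_add, ih]
      simp [add_assoc]
  exact Fin.ext ((h a).trans (Fin.val_add i a).symm)

theorem cyclicKey_injective {m : ℕ} (w : Fin (m + 1) → ℕ) (hw : ∀ i, w i = w 0 → i = 0) :
    Function.Injective (cyclicKey w) := by
  intro i j h
  have h1 : w ((finRotate (m + 1) ^ ((-i : Fin (m + 1)) : ℕ)) i)
      = w ((finRotate (m + 1) ^ ((-i : Fin (m + 1)) : ℕ)) j) :=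
    congrFun (toLex.injective h) _
  simp only [finRotate_pow_val_apply, add_neg_cancel] at h1
  have h2 := hw _ h1.symm
  exact (add_neg_eq_zero.1 h2).symm

theorem monotone_cyclicKey_iff {m : ℕ} {c : Fin (m + 1) → ℕ} {k : Fin (m + 1)} (hc : Monotone c)
    (hk : ∀ x, c x = c k → x = k) (ρ : Equiv.Perm (Fin (m + 1))) (h0 : ρ 0 = k) :
    Monotone (cyclicKey (c ∘ ρ) ∘ ⇑ρ⁻¹) ↔
      StrictMonoOnFibers c ⇑(ρ * finRotate (m + 1) * ρ⁻¹) := by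
  constructor
  · intro h x y hxy hcxy
    have hinj : Function.Injective (cyclicKey (c ∘ ρ)) := by
      refine cyclicKey_injective _ fun i hi => ρ.injective ?_
      rw [h0]
      exact hk _ (by simpa [h0] using hi)
    have h1 : cyclicKey (c ∘ ρ) (ρ⁻¹ x) < cyclicKey (c ∘ ρ) (ρ⁻¹ y) :=
      lt_of_le_of_ne (h hxy.le) fun h2 => hxy.ne (ρ⁻¹.injective (hinj h2))
    obtain ⟨l, hl, hlt⟩ := (cyclicKey_lt_iff _ _ _).1 h1
    cases l with
    | zero => simp [hcxy] at hlt
    | succ l =>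
      have h3 : cyclicKey (c ∘ ρ) (finRotate _ (ρ⁻¹ x))
          < cyclicKey (c ∘ ρ) (finRotate _ (ρ⁻¹ y)) := by
        refine (cyclicKey_lt_iff _ _ _).2 ⟨l, fun s hs => ?_, ?_⟩
        · simpa [pow_succ] using hl (s + 1) (by omega)
        · simpa [pow_succ] using hlt
      by_contra! h4
      have h5 := h h4
      simp only [Function.comp_apply, Equiv.Perm.mul_apply, Equiv.Perm.inv_def, Equiv.symm_apply_apply] at h5
      exact h5.not_gt h3
  · intro h x y hxy
    have key : ∀ l i j,
        (∀ s < l, (c ∘ ρ) ((finRotate (m + 1) ^ s) i) = (c ∘ ρ) ((finRotate (m + 1) ^ s) j)) →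
        (c ∘ ρ) ((finRotate (m + 1) ^ l) i) < (c ∘ ρ) ((finRotate (m + 1) ^ l) j) →
        ρ i < ρ j := by
      intro l
      induction l with
      | zero =>
        intro i j _ hlt
        exact hc.reflect_lt (by simpa using hlt)
      | succ l ih =>
        intro i j heq hlt
        have h1 : ρ (finRotate _ i) < ρ (finRotate _ j) := by
          refine ih _ _ (fun s hs => ?_) ?_
          · simpa [pow_succ] using heq (s + 1) (by omega)
          · simpa [pow_succ] using hlt
        by_contra! h2
        rcases h2.eq_or_lt with h2 | h2
        · rw [ρ.injective h2] at h1
          exact lt_irrefl _ h1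
        · have h3 := h _ _ h2 (by simpa using (heq 0 (by omega)).symm)
          simp only [Equiv.Perm.mul_apply, Equiv.Perm.inv_def, Equiv.symm_apply_apply] at h3
          exact h3.not_gt h1
    by_contra! h1
    obtain ⟨l, hl, hlt⟩ := (cyclicKey_lt_iff _ _ _).1 h1
    have := key l _ _ hl hlt
    simp only [← Equiv.Perm.mul_apply, mul_inv_cancel, Equiv.Perm.one_apply] at this
    exact this.not_ge hxy

theorem isCyclic'_finRotate_conj {m : ℕ} (ρ : Equiv.Perm (Fin (m + 1))) :
    IsCyclic' (ρ * finRotate (m + 1) * ρ⁻¹) := by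
  intro x y
  refine ⟨((ρ⁻¹ y - ρ⁻¹ x : Fin (m + 1)) : ℕ), ?_⟩
  rw [conj_pow]
  simp [finRotate_pow_val_apply]

theorem IsCyclic'.isCycle_and_support {m : ℕ} {π : Equiv.Perm (Fin (m + 2))} (h : IsCyclic' π) :
    π.IsCycle ∧ π.support = Finset.univ := by
  have hne : ∀ x, π x ≠ x := by
    intro x hx
    obtain ⟨y, hy⟩ := exists_ne x
    obtain ⟨j, hj⟩ := h x y
    rw [Equiv.Perm.pow_apply_eq_self_of_apply_eq_self hx] at hj
    exact hy hj.symm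
  refine ⟨⟨0, hne 0, fun y _ => ?_⟩, ?_⟩
  · obtain ⟨j, hj⟩ := h 0 y
    exact ⟨j, by simpa using hj⟩
  · ext x
    simp [hne x]

theorem IsCyclic'.exists_eq_conj_finRotate {m : ℕ} {π : Equiv.Perm (Fin (m + 1))}
    (h : IsCyclic' π) (k : Fin (m + 1)) :
    ∃ ρ : Equiv.Perm (Fin (m + 1)), ρ 0 = k ∧ ρ * finRotate (m + 1) * ρ⁻¹ = π := by
  obtain ⟨g, hg⟩ : ∃ g : Equiv.Perm (Fin (m + 1)), g * finRotate (m + 1) * g⁻¹ = π := by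
    cases m with
    | zero => exact ⟨1, Equiv.ext fun _ => Subsingleton.elim (α := Fin 1) _ _⟩
    | succ m =>
      obtain ⟨h1, h2⟩ := h.isCycle_and_support
      have := isCycle_finRotate.isConj h1 (by rw [h2, support_finRotate])
      exact isConj_iff.1 this
  refine ⟨g * finRotate (m + 1) ^ ((g⁻¹ k : Fin (m + 1)) : ℕ), ?_, ?_⟩
  · simp [finRotate_pow_val_apply]
  · rw [← hg]
    have hcomm := (Commute.refl (finRotate (m + 1))).pow_left ((g⁻¹ k : Fin (m + 1)) : ℕ)
    rw [mul_inv_rev, mul_assoc g, hcomm.eq]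
    group

theorem bijOn_conj_finRotate {m : ℕ} (k : Fin (m + 1)) (p : Equiv.Perm (Fin (m + 1)) → Prop) :
    Set.BijOn (fun ρ : Equiv.Perm (Fin (m + 1)) => ρ * finRotate (m + 1) * ρ⁻¹)
      {ρ | ρ 0 = k ∧ p (ρ * finRotate (m + 1) * ρ⁻¹)} {π | IsCyclic' π ∧ p π} := by
  refine ⟨fun ρ hρ => ⟨isCyclic'_finRotate_conj ρ, hρ.2⟩, ?_, ?_⟩
  · rintro ρ ⟨h0, -⟩ ρ' ⟨h0', -⟩ (heq : ρ * finRotate (m + 1) * ρ⁻¹ = _)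
    ext1 i
    have h1 := DFunLike.congr_fun (congrArg (· ^ (i : ℕ)) heq) k
    simp only [conj_pow, Equiv.Perm.mul_apply, finRotate_pow_val_apply,
      Equiv.Perm.inv_eq_iff_eq.2 h0.symm, Equiv.Perm.inv_eq_iff_eq.2 h0'.symm] at h1
    simpa using h1
  · rintro π ⟨hπ, hp⟩
    obtain ⟨ρ, h0, rfl⟩ := hπ.exists_eq_conj_finRotate k
    exact ⟨ρ, ⟨h0, hp⟩, rfl⟩

/-- Gessel–Reutenauer count: if `c` is monotone with `{k}` as a fiber, then the full cycles
increasing on the fibers of `c` are as many as the permutations `ρ⁻¹` with `ρ 0 = k` that do so. -/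
theorem ncard_cyclic_strictMonoOnFibers {m : ℕ} {c : Fin (m + 1) → ℕ} {k : Fin (m + 1)}
    (hc : Monotone c) (hk : ∀ x, c x = c k → x = k) :
    {π : Equiv.Perm (Fin (m + 1)) | IsCyclic' π ∧ StrictMonoOnFibers c π}.ncard
      = {ρ : Equiv.Perm (Fin (m + 1)) | ρ 0 = k ∧ StrictMonoOnFibers c ⇑ρ⁻¹}.ncard := by
  have h1 := bijOn_comp_of_key hc hk cyclicKey apply_le_of_cyclicKey_le cyclicKey_injective
  have h2 := bijOn_comp_of_key hc hk (fun w i => toLex (w i, i))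
    (fun w i j h => by
      rw [Prod.Lex.toLex_le_toLex] at h
      rcases h with h | h
      · exact h.le
      · exact h.1.le)
    (fun w _ i j h => congrArg Prod.snd (toLex.injective h))
  have h3 := bijOn_conj_finRotate k fun π => StrictMonoOnFibers c π
  have e1 : {ρ : Equiv.Perm (Fin (m + 1)) | ρ 0 = k ∧ Monotone (cyclicKey (c ∘ ρ) ∘ ⇑ρ⁻¹)}
      = {ρ | ρ 0 = k ∧ StrictMonoOnFibers c ⇑(ρ * finRotate (m + 1) * ρ⁻¹)} :=
    Set.ext fun ρ => and_congr_right fun h0 => monotone_cyclicKey_iff hc hk ρ h0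
  have e2 : {ρ : Equiv.Perm (Fin (m + 1)) |
        ρ 0 = k ∧ Monotone ((fun i => toLex ((c ∘ ρ) i, i)) ∘ ⇑ρ⁻¹)}
      = {ρ : Equiv.Perm (Fin (m + 1)) | ρ 0 = k ∧ StrictMonoOnFibers c ⇑ρ⁻¹} :=
    Set.ext fun ρ => and_congr_right fun _ => monotone_prodKey_iff hc ρ
  rw [e1] at h1
  rw [e2] at h2
  rw [← Nat.card_coe_set_eq, ← Nat.card_coe_set_eq, ← Nat.card_congr (h3.equiv _),
    Nat.card_congr (h1.equiv _), Nat.card_congr (h2.equiv _)]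

/-- The index of the block containing `x` when positions are cut after every element of `I` and
on both sides of `k`. -/
def blockIndex (I : Finset ℕ) (k x : ℕ) : ℕ :=
  ((Finset.range x).filter fun i => i ∈ I ∨ i + 1 = k ∨ i = k).card

theorem blockIndex_mono (I : Finset ℕ) (k : ℕ) : Monotone (blockIndex I k) := fun _ _ h =>
  Finset.card_le_card (Finset.filter_subset_filter _ (Finset.range_mono h))

theorem blockIndex_succ_eq_iff (I : Finset ℕ) (k i : ℕ) :
    blockIndex I k i = blockIndex I k (i + 1) ↔ ¬ (i ∈ I ∨ i + 1 = k ∨ i = k) := by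
  unfold blockIndex
  rw [Finset.range_add_one, Finset.filter_insert]
  split_ifs with h <;> simp [h]

theorem eq_of_blockIndex_eq (I : Finset ℕ) {k x : ℕ} (h : blockIndex I k x = blockIndex I k k) :
    x = k := by
  have hm := blockIndex_mono I k
  rcases lt_trichotomy x k with hlt | rfl | hlt
  · obtain ⟨j, rfl⟩ : ∃ j, k = j + 1 := ⟨k - 1, by omega⟩
    have h1 := hm (show x ≤ j by omega)
    have h2 := hm (show j ≤ j + 1 by omega)
    have h3 := (blockIndex_succ_eq_iff I (j + 1) j).1 (by omega)
    simp at h3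
  · rfl
  · have h1 := hm (show k + 1 ≤ x by omega)
    have h2 := hm (show k ≤ k + 1 by omega)
    have h3 := (blockIndex_succ_eq_iff I k k).1 (by omega)
    simp at h3

theorem descSeq_subset_iff {m : ℕ} {f : Fin (m + 1) → ℕ} (hf : Function.Injective f)
    {k : Fin (m + 1)} (hk : f k = 0) (I : Finset ℕ) :
    descSeq f ⊆ I ↔ (∀ i, i + 1 = (k : ℕ) → i ∈ I) ∧
      StrictMonoOnFibers (fun x : Fin (m + 1) => blockIndex I k x) f := by
  have hmem : ∀ i, i ∈ descSeq f ↔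
      ∃ h : i + 1 < m + 1, f ⟨i + 1, h⟩ < f ⟨i, Nat.lt_of_succ_lt h⟩ := by
    intro i
    simp only [descSeq, Finset.mem_filter, Finset.mem_range, and_iff_right_iff_imp]
    rintro ⟨h, -⟩
    omega
  constructor
  · intro h
    refine ⟨fun i hi => h ((hmem i).2 ⟨hi ▸ k.2, ?_⟩), ?_⟩
    · have h1 : (⟨i + 1, hi ▸ k.2⟩ : Fin (m + 1)) = k := Fin.ext hi
      rw [h1, hk]
      refine Nat.pos_of_ne_zero fun h2 => ?_
      have := congrArg Fin.val (hf (h2.trans hk.symm))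
      simp only at this
      omega
    · suffices H : ∀ x y (hx : x < m + 1) (hy : y < m + 1), x < y →
          blockIndex I k x = blockIndex I k y → f ⟨x, hx⟩ < f ⟨y, hy⟩ from
        fun x y hxy hb => H x y x.2 y.2 hxy hb
      intro x y hx hy hxy hb
      induction y, hxy using Nat.le_induction with
      | base =>
        have h1 := (blockIndex_succ_eq_iff I k x).1 hb
        refine lt_of_le_of_ne (not_lt.1 fun h2 => h1 (Or.inl (h ((hmem x).2 ⟨hy, h2⟩)))) fun h2 => ?_
        have := congrArg Fin.val (hf h2)
        simp at this
      | succ y hxy ih =>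
        have m1 := blockIndex_mono I k (show x ≤ y by omega)
        have m2 := blockIndex_mono I k (show y ≤ y + 1 by omega)
        have h1 := (blockIndex_succ_eq_iff I k y).1 (by omega)
        refine (ih (by omega) (by omega)).trans_le
          (not_lt.1 fun h2 => h1 (Or.inl (h ((hmem y).2 ⟨hy, h2⟩))))
  · rintro ⟨h1, h2⟩ i hi
    obtain ⟨hlt, hd⟩ := (hmem i).1 hi
    by_contra hI
    by_cases hk1 : i + 1 = k
    · exact hI (h1 i hk1)
    by_cases hk2 : i = k
    · have : (⟨i, Nat.lt_of_succ_lt hlt⟩ : Fin (m + 1)) = k := Fin.ext hk2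
      rw [this, hk] at hd
      omega
    · have := h2 ⟨i, Nat.lt_of_succ_lt hlt⟩ ⟨i + 1, hlt⟩ (Fin.mk_lt_mk.2 (by omega))
        ((blockIndex_succ_eq_iff I k i).2 (by tauto))
      omega

/-- The values of `π` as a sequence, shifted to start at `1` and entry `k` set to `0`. -/
def zeroAt {n : ℕ} (π : Equiv.Perm (Fin n)) (k : Fin n) : Fin n → ℕ :=
  Function.update (fun i => ((π i : ℕ) + 1)) k 0

theorem zeroAt_eq_zero_iff {n : ℕ} (π : Equiv.Perm (Fin n)) (k i : Fin n) :
    zeroAt π k i = 0 ↔ i = k := by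
  by_cases h : i = k <;> simp [zeroAt, h]

theorem zeroAt_of_ne {n : ℕ} (π : Equiv.Perm (Fin n)) {k i : Fin n} (h : i ≠ k) :
    zeroAt π k i = (π i : ℕ) + 1 := by
  simp [zeroAt, h]

theorem zeroAt_injective {n : ℕ} (π : Equiv.Perm (Fin n)) (k : Fin n) :
    Function.Injective (zeroAt π k) := by
  intro i j h
  by_cases hi : i = k
  · rw [hi, (zeroAt_eq_zero_iff π k k).2 rfl, eq_comm, zeroAt_eq_zero_iff] at h
    rw [hi, h]
  by_cases hj : j = k
  · rwa [hj, (zeroAt_eq_zero_iff π k k).2 rfl, zeroAt_eq_zero_iff, ← hj] at h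
  · rw [zeroAt_of_ne π hi, zeroAt_of_ne π hj] at h
    exact π.injective (Fin.ext (by omega))

theorem zeroAt_inj {n : ℕ} {π π' : Equiv.Perm (Fin n)} {k k' : Fin n}
    (h : zeroAt π k = zeroAt π' k') : k = k' ∧ π = π' := by
  have hk : k = k' := by
    rw [← zeroAt_eq_zero_iff π' k' k, ← h, zeroAt_eq_zero_iff]
  subst hk
  have hne : ∀ i, i ≠ k → π i = π' i := fun i hi => by
    have := congrFun h i
    rw [zeroAt_of_ne π hi, zeroAt_of_ne π' hi] at this
    exact Fin.ext (by omega)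
  refine ⟨rfl, Equiv.ext fun i => ?_⟩
  by_cases hi : i = k
  · subst hi
    obtain ⟨x, hx⟩ := π'.surjective (π i)
    by_cases hxi : x = i
    · rw [← hx, hxi]
    · exact absurd (π.injective ((hne x hxi).trans hx)) hxi
  · exact hne i hi

theorem strictMonoOnFibers_zeroAt_iff {m : ℕ} {c : Fin (m + 1) → ℕ} {k : Fin (m + 1)}
    (hk : ∀ x, c x = c k → x = k) (π : Equiv.Perm (Fin (m + 1))) :
    StrictMonoOnFibers c (zeroAt π k) ↔ StrictMonoOnFibers c π := by
  refine forall_congr' fun x => forall_congr' fun y => forall_congr' fun hxy =>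
    forall_congr' fun hc => ?_
  have hx : x ≠ k := fun h => by
    subst h
    exact hxy.ne (hk y hc.symm).symm
  have hy : y ≠ k := fun h => by
    subst h
    exact hxy.ne (hk x hc)
  rw [zeroAt_of_ne π hx, zeroAt_of_ne π hy, Fin.lt_def]
  omega

theorem ncard_descSeq_zeroAt_subset {m : ℕ} (k : Fin (m + 1)) (I : Finset ℕ) :
    {π : Equiv.Perm (Fin (m + 1)) | IsCyclic' π ∧ descSeq (zeroAt π k) ⊆ I}.ncard
      = {ρ : Equiv.Perm (Fin (m + 1)) | ρ 0 = k ∧ descSet ρ⁻¹ ⊆ I}.ncard := by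
  have hk : ∀ x : Fin (m + 1), blockIndex I k x = blockIndex I k k → x = k :=
    fun x hx => Fin.ext (eq_of_blockIndex_eq I hx)
  have e1 : ∀ π : Equiv.Perm (Fin (m + 1)), descSeq (zeroAt π k) ⊆ I ↔
      (∀ i, i + 1 = (k : ℕ) → i ∈ I) ∧
        StrictMonoOnFibers (fun x : Fin (m + 1) => blockIndex I k x) π := fun π => by
    rw [descSeq_subset_iff (zeroAt_injective π k) ((zeroAt_eq_zero_iff π k k).2 rfl) I,
      strictMonoOnFibers_zeroAt_iff hk]
  have e2 : ∀ ρ : Equiv.Perm (Fin (m + 1)), ρ 0 = k → (descSet ρ⁻¹ ⊆ I ↔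
      (∀ i, i + 1 = (k : ℕ) → i ∈ I) ∧
        StrictMonoOnFibers (fun x : Fin (m + 1) => blockIndex I k x) ⇑ρ⁻¹) := fun ρ h0 =>
    descSeq_subset_iff (fun x y h => ρ⁻¹.injective (Fin.ext h)) (by simp [← h0]) I
  have e3 : {ρ : Equiv.Perm (Fin (m + 1)) | ρ 0 = k ∧ descSet ρ⁻¹ ⊆ I}
      = {ρ : Equiv.Perm (Fin (m + 1)) | ρ 0 = k ∧ (∀ i, i + 1 = (k : ℕ) → i ∈ I) ∧
        StrictMonoOnFibers (fun x : Fin (m + 1) => blockIndex I k x) ⇑ρ⁻¹} :=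
    Set.ext fun ρ => and_congr_right (e2 ρ)
  rw [e3]
  simp only [e1]
  by_cases hI : ∀ i, i + 1 = (k : ℕ) → i ∈ I
  · have hc : Monotone fun x : Fin (m + 1) => blockIndex I k x :=
      fun x y h => blockIndex_mono I k h
    simpa only [eq_true hI, true_and] using ncard_cyclic_strictMonoOnFibers hc hk
  · simp only [hI, false_and, and_false]

open scoped Classical in
theorem card_descSeq_zeroAt_eq {m : ℕ} (k : Fin (m + 1)) (I : Finset ℕ) :
    (Finset.univ.filter fun π : {π : Equiv.Perm (Fin (m + 1)) // IsCyclic' π} =>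
        descSeq (zeroAt π.1 k) = I).card
      = (Finset.univ.filter fun ρ : {ρ : Equiv.Perm (Fin (m + 1)) // ρ 0 = k} =>
        descSet ρ.1⁻¹ = I).card := by
  refine card_filter_eq_of_card_filter_subset _ _ _ _ (fun J => ?_) I
  have h := ncard_descSeq_zeroAt_subset k J
  have key : ∀ p q : Equiv.Perm (Fin (m + 1)) → Prop,
      (Finset.univ.filter fun π : {π // p π} => q π.1).card = {π | p π ∧ q π}.ncard := by
    intro p q
    rw [← Fintype.card_subtype, ← Nat.card_eq_fintype_card, ← Nat.card_coe_set_eq]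
    exact Nat.card_congr (Equiv.subtypeSubtypeEquivSubtypeInter p q)
  convert (key _ fun π => descSeq (zeroAt π k) ⊆ J).trans
    (h.trans (key _ fun ρ => descSet ρ⁻¹ ⊆ J).symm)

theorem bijective_zeroAt (n : ℕ) : Function.Bijective
    (fun p : (_ : Fin n) × {π : Equiv.Perm (Fin n) // IsCyclic' π} =>
      (⟨zeroAt p.2.1 p.1, p.2.1, p.1, p.2.2, rfl⟩ : {τ : Fin n → ℕ // InT0 n τ})) := by
  constructor
  · rintro ⟨k, π, hπ⟩ ⟨k', π', hπ'⟩ h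
    obtain ⟨rfl, rfl⟩ := zeroAt_inj (congrArg Subtype.val h)
    rfl
  · rintro ⟨_, π, k, hπ, rfl⟩
    exact ⟨⟨k, π, hπ⟩, rfl⟩

theorem stmt8 (n : ℕ) (hn : 1 ≤ n) :
    ∃ ψ : {τ : Fin n → ℕ // InT0 n τ} ≃ Equiv.Perm (Fin n),
      ∀ τ : {τ : Fin n → ℕ // InT0 n τ},
        descSeq τ.1 = descSet (ψ τ) ∧
        ∀ k : Fin n, τ.1 k = 0 → ((ψ τ) k : ℕ) = 0 := by
  classical
  obtain ⟨m, rfl⟩ : ∃ m, n = m + 1 := ⟨n - 1, by omega⟩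
  have he := fun k : Fin (m + 1) => exists_equiv_of_card_fiber_eq
    (fun π : {π : Equiv.Perm (Fin (m + 1)) // IsCyclic' π} => descSeq (zeroAt π.1 k))
    (fun ρ : {ρ : Equiv.Perm (Fin (m + 1)) // ρ 0 = k} => descSet ρ.1⁻¹)
    (card_descSeq_zeroAt_eq k)
  choose e he using he
  let E := Equiv.ofBijective _ (bijective_zeroAt (m + 1))
  refine ⟨(E.symm.trans ((Equiv.sigmaCongrRight e).trans
    (Equiv.sigmaFiberEquiv fun ρ : Equiv.Perm (Fin (m + 1)) => ρ 0))).trans (Equiv.inv _),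
    fun τ => ?_⟩
  obtain ⟨⟨k, π⟩, rfl⟩ := E.surjective τ
  simp only [Equiv.trans_apply, Equiv.symm_apply_apply]
  refine ⟨(he k π).symm, fun j hj => ?_⟩
  obtain rfl : j = k := (zeroAt_eq_zero_iff π.1 k j).1 hj
  have h0 : ((e j π).1)⁻¹ j = 0 := Equiv.Perm.inv_eq_iff_eq.2 (e j π).2.symm
  exact congrArg Fin.val h0
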